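/- Let N ≥ 1, 0 < γ < min{2,N}, p > p_F := 1 + 2/N and z ∈ ℝ^N \ {0}. There exists a constant c* > 0 depending only on N, p, γ (and not on z) such that if u₀ is a nonnegative measurable function on ℝ^N satisfying u₀(x) ≤ c |z|^{γ/(p−1)} |x−z|^{−2/(p−1)} for all x ∈ ℝ^N \ {z} with 0 < c ≤ c*, then the Hardy parabolic equation ∂_t u − Δu = |x|^{−γ} u^p with initial data u₀ possesses a global-in-time solution on ℝ^N × [0,∞). -/

import Mathlib

open MeasureTheory Real Set

noncomputable def heatKernel (N : ℕ) (x : EuclideanSpace ℝ (Fin N)) (t : ℝ) : ℝ :=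
  (4 * Real.pi * t) ^ (-(N : ℝ) / 2) * Real.exp (-‖x‖ ^ 2 / (4 * t))

/-- `u` is a (nonnegative, integral) solution of `∂_t u - Δu = |x|^{-γ} u^p`
with initial data the nonnegative measurable function `u₀`, on `ℝ^N × [0,∞)`. -/
def IsGlobalSol (N : ℕ) (γ p : ℝ) (u₀ : EuclideanSpace ℝ (Fin N) → ℝ)
    (u : EuclideanSpace ℝ (Fin N) → ℝ → ℝ) : Prop :=
  Measurable (Function.uncurry u) ∧ (∀ x t, 0 ≤ u x t) ∧
    ∀ᵐ q : EuclideanSpace ℝ (Fin N) × ℝ,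
      0 < q.2 →
        u q.1 q.2 = (∫ y, heatKernel N (q.1 - y) q.2 * u₀ y) +
          ∫ s in Set.Ioo 0 q.2, ∫ y,
            heatKernel N (q.1 - y) (q.2 - s) * ‖y‖ ^ (-γ) * u y s ^ p

open scoped ENNReal

lemma heatKernel_nonneg (N : ℕ) (x : EuclideanSpace ℝ (Fin N)) {t : ℝ} (ht : 0 < t) :
    0 ≤ heatKernel N x t := by
  unfold heatKernel; positivity

lemma measurable_heatKernel (N : ℕ) :
    Measurable fun q : EuclideanSpace ℝ (Fin N) × ℝ => heatKernel N q.1 q.2 := by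
  unfold heatKernel; fun_prop

/-- The heat kernel is dominated by a negative power of the parabolic distance. -/
lemma heatKernel_le_rpow (N : ℕ) (hN : 1 ≤ N) :
    ∃ C : ℝ, 0 < C ∧ ∀ (x : EuclideanSpace ℝ (Fin N)) (t : ℝ), 0 < t →
      heatKernel N x t ≤ C * (‖x‖ ^ 2 + t) ^ (-(N : ℝ) / 2) := by
  obtain ⟨n, hn⟩ : ∃ n : ℝ, n = (N : ℝ) / 2 := ⟨_, rfl⟩
  have hn0 : 0 < n := by
    have : (1 : ℝ) ≤ N := by exact_mod_cast hN
    rw [hn]; linarith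
  refine ⟨(4 * π) ^ (-n) * ((4 * n) ^ n * exp (1 / 4)), by positivity, fun x t ht => ?_⟩
  have hneg : -(N : ℝ) / 2 = -n := by rw [hn]; ring
  unfold heatKernel
  rw [hneg]
  set ξ := ‖x‖ ^ 2 / t with hξ
  have hξ0 : 0 ≤ ξ := by positivity
  have h1 : -‖x‖ ^ 2 / (4 * t) = -ξ / 4 := by rw [hξ]; field_simp
  have h2 : ‖x‖ ^ 2 + t = t * (1 + ξ) := by rw [hξ]; field_simp; ring
  have h3 : (1 + ξ) ^ n ≤ (4 * n) ^ n * exp ((1 + ξ) / 4) := by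
    have h4 : 1 + ξ ≤ 4 * n * exp ((1 + ξ) / (4 * n)) := by
      have h5 := add_one_le_exp ((1 + ξ) / (4 * n))
      have h6 : (1 + ξ) / (4 * n) ≤ exp ((1 + ξ) / (4 * n)) := by linarith
      rwa [div_le_iff₀' (by positivity)] at h6
    refine (rpow_le_rpow (by positivity) h4 hn0.le).trans_eq ?_
    rw [mul_rpow (by positivity) (by positivity), ← exp_mul]
    congr 2
    field_simp
  have h7 : exp (-ξ / 4) ≤ (4 * n) ^ n * exp (1 / 4) * (1 + ξ) ^ (-n) := by
    rw [rpow_neg (by positivity), ← div_eq_mul_inv, le_div_iff₀ (by positivity)]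
    calc exp (-ξ / 4) * (1 + ξ) ^ n ≤ exp (-ξ / 4) * ((4 * n) ^ n * exp ((1 + ξ) / 4)) := by gcongr
      _ = (4 * n) ^ n * (exp (-ξ / 4) * exp ((1 + ξ) / 4)) := by ring
      _ = (4 * n) ^ n * exp (1 / 4) := by rw [← exp_add]; congr 2; ring
  rw [h1, h2, mul_rpow (by positivity) ht.le, mul_rpow ht.le (by positivity)]
  calc (4 * π) ^ (-n) * t ^ (-n) * exp (-ξ / 4)
      ≤ (4 * π) ^ (-n) * t ^ (-n) * ((4 * n) ^ n * exp (1 / 4) * (1 + ξ) ^ (-n)) := by gcongr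
    _ = _ := by ring

/-- The semigroup property of the heat kernel. -/
lemma lintegral_heatKernel_mul_heatKernel (N : ℕ) (x : EuclideanSpace ℝ (Fin N)) {t s : ℝ}
    (ht : 0 < t) (hs : 0 < s) :
    ∫⁻ y, ENNReal.ofReal (heatKernel N (x - y) t) * ENNReal.ofReal (heatKernel N y s) =
      ENNReal.ofReal (heatKernel N x (t + s)) := by
  set b : ℝ := (t + s) / (4 * t * s) with hb
  have hb0 : 0 < b := by positivity
  set a : ℝ := s / (t + s) with ha
  have hsq (y : EuclideanSpace ℝ (Fin N)) :
      -‖x - y‖ ^ 2 / (4 * t) + -‖y‖ ^ 2 / (4 * s) =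
        -‖x‖ ^ 2 / (4 * (t + s)) + -b * ‖y - a • x‖ ^ 2 := by
    rw [norm_sub_sq_real, norm_sub_sq_real, inner_smul_right, norm_smul, norm_eq_abs,
      mul_pow, sq_abs, real_inner_comm, hb, ha]
    field_simp
    ring
  have hint : Integrable fun y : EuclideanSpace ℝ (Fin N) => exp (-b * ‖y‖ ^ 2) := by
    refine Integrable.of_integral_ne_zero ?_
    rw [GaussianFourier.integral_rexp_neg_mul_sq_norm hb0]
    positivity
  have hconst : (4 * π * t) ^ (-(N : ℝ) / 2) * (4 * π * s) ^ (-(N : ℝ) / 2) *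
      (π / b) ^ ((N : ℝ) / 2) = (4 * π * (t + s)) ^ (-(N : ℝ) / 2) := by
    have h1 : -(N : ℝ) / 2 = -((N : ℝ) / 2) := by ring
    rw [h1, rpow_neg (by positivity), rpow_neg (by positivity), rpow_neg (by positivity),
      ← inv_rpow (by positivity), ← inv_rpow (by positivity), ← inv_rpow (by positivity),
      ← mul_rpow (by positivity) (by positivity), ← mul_rpow (by positivity) (by positivity), hb]
    congr 1
    field_simp
  calc ∫⁻ y, ENNReal.ofReal (heatKernel N (x - y) t) * ENNReal.ofReal (heatKernel N y s)
      = ∫⁻ y, ENNReal.ofReal ((4 * π * t) ^ (-(N : ℝ) / 2) * (4 * π * s) ^ (-(N : ℝ) / 2) *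
          exp (-‖x‖ ^ 2 / (4 * (t + s)))) * ENNReal.ofReal (exp (-b * ‖y - a • x‖ ^ 2)) := by
        refine lintegral_congr fun y => ?_
        rw [← ENNReal.ofReal_mul (heatKernel_nonneg N _ ht), ← ENNReal.ofReal_mul (by positivity),
          mul_assoc, ← exp_add, ← hsq, exp_add]
        unfold heatKernel
        congr 1
        ring
    _ = ENNReal.ofReal ((4 * π * t) ^ (-(N : ℝ) / 2) * (4 * π * s) ^ (-(N : ℝ) / 2) *
          exp (-‖x‖ ^ 2 / (4 * (t + s)))) *
          ENNReal.ofReal ((π / b) ^ ((N : ℝ) / 2)) := by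
        rw [lintegral_const_mul _ (by fun_prop),
          lintegral_sub_right_eq_self
            (fun y : EuclideanSpace ℝ (Fin N) => ENNReal.ofReal (exp (-b * ‖y‖ ^ 2))) (a • x),
          ← ofReal_integral_eq_lintegral_ofReal hint (ae_of_all _ fun y => (exp_pos _).le),
          GaussianFourier.integral_rexp_neg_mul_sq_norm hb0, finrank_euclideanSpace_fin]
    _ = ENNReal.ofReal (heatKernel N x (t + s)) := by
        rw [← ENNReal.ofReal_mul (by positivity), heatKernel, ← hconst]
        congr 1
        ring

/-- The heat semigroup acts on a superposition of Gaussians by shifting their times. -/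
lemma lintegral_heatKernel_mul_mixture (N : ℕ) (x : EuclideanSpace ℝ (Fin N)) {t : ℝ}
    (ht : 0 < t) {k : ℝ → ℝ≥0∞} (hk : Measurable k) :
    ∫⁻ y, ENNReal.ofReal (heatKernel N (x - y) t) *
        ∫⁻ τ in Ioi 0, ENNReal.ofReal (heatKernel N y τ) * k τ =
      ∫⁻ τ in Ioi 0, ENNReal.ofReal (heatKernel N x (t + τ)) * k τ := by
  have hK := measurable_heatKernel N
  have hm : Measurable fun q : EuclideanSpace ℝ (Fin N) × ℝ =>
      ENNReal.ofReal (heatKernel N (x - q.1) t) *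
        (ENNReal.ofReal (heatKernel N q.1 q.2) * k q.2) := by
    refine Measurable.mul ?_ (hK.ennreal_ofReal.mul (hk.comp measurable_snd))
    exact (hK.comp (f := fun q : EuclideanSpace ℝ (Fin N) × ℝ => (x - q.1, t))
      (by fun_prop)).ennreal_ofReal
  calc _ = ∫⁻ y, ∫⁻ τ in Ioi 0, ENNReal.ofReal (heatKernel N (x - y) t) *
        (ENNReal.ofReal (heatKernel N y τ) * k τ) := by
        refine lintegral_congr fun y => (lintegral_const_mul _ ?_).symm
        exact (hK.comp (f := fun τ : ℝ => (y, τ)) (by fun_prop)).ennreal_ofReal.mul hk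
    _ = ∫⁻ τ in Ioi 0, ∫⁻ y, ENNReal.ofReal (heatKernel N (x - y) t) *
        (ENNReal.ofReal (heatKernel N y τ) * k τ) := lintegral_lintegral_swap hm.aemeasurable
    _ = _ := by
        refine setLIntegral_congr_fun measurableSet_Ioi fun τ hτ => ?_
        have hm' : Measurable fun y : EuclideanSpace ℝ (Fin N) =>
            ENNReal.ofReal (heatKernel N (x - y) t) * ENNReal.ofReal (heatKernel N y τ) := by
          refine Measurable.mul (f := fun y => ENNReal.ofReal (heatKernel N (x - y) t))
            (g := fun y => ENNReal.ofReal (heatKernel N y τ)) ?_ ?_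
          · exact (hK.comp (f := fun y : EuclideanSpace ℝ (Fin N) => (x - y, t))
              (by fun_prop)).ennreal_ofReal
          · exact (hK.comp (f := fun y : EuclideanSpace ℝ (Fin N) => (y, τ))
              (by fun_prop)).ennreal_ofReal
        simp only [← mul_assoc]
        rw [lintegral_mul_const _ hm', lintegral_heatKernel_mul_heatKernel N x ht hτ]

/-- Products of powers of `‖y‖` and of `‖y‖ ^ 2 + s` are dominated by superpositions of
Gaussians. -/
lemma exists_rpow_le_mixture (N : ℕ) {γ e : ℝ} (hγ : γ < N) (he : 0 ≤ e) :
    ∃ C : ℝ, 0 < C ∧ ∀ (y : EuclideanSpace ℝ (Fin N)) (s : ℝ), y ≠ 0 → 0 ≤ s →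
      ENNReal.ofReal (‖y‖ ^ (-γ) * (‖y‖ ^ 2 + s) ^ (-e)) ≤
        ENNReal.ofReal C * ∫⁻ τ in Ioi 0, ENNReal.ofReal (heatKernel N y τ) *
          ENNReal.ofReal ((s + τ) ^ (-e) * τ ^ (((N : ℝ) - γ) / 2 - 1)) := by
  set c : ℝ := (8 * π) ^ (-(N : ℝ) / 2) * exp (-(1 / 4)) * (2 : ℝ) ^ (-e) / 2 with hc
  have hc0 : 0 < c := by positivity
  refine ⟨c⁻¹, by positivity, fun y s hy hs => ?_⟩
  set r := ‖y‖ ^ 2 with hr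
  have hr0 : 0 < r := by have := norm_pos_iff.2 hy; positivity
  set κ := ((N : ℝ) - γ) / 2 with hκ
  have hκ0 : 0 < κ := by rw [hκ]; linarith
  have hyr : ‖y‖ ^ (-γ) = r ^ (-γ / 2) := by
    rw [hr, ← rpow_natCast, ← rpow_mul (norm_nonneg y)]; congr 1; push_cast; ring
  have hpt : ∀ τ ∈ Ioc r (2 * r), c * (r ^ (-γ / 2) * (r + s) ^ (-e)) * r⁻¹ ≤
      heatKernel N y τ * ((s + τ) ^ (-e) * τ ^ (κ - 1)) := by
    rintro τ ⟨h1, h2⟩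
    have hτ : 0 < τ := hr0.trans h1
    have e1 : (8 * π) ^ (-(N : ℝ) / 2) * r ^ (-(N : ℝ) / 2) ≤ (4 * π * τ) ^ (-(N : ℝ) / 2) := by
      rw [← mul_rpow (by positivity) hr0.le]
      refine rpow_le_rpow_of_nonpos (by positivity) ?_ ?_
      · nlinarith [pi_pos]
      · have : (0 : ℝ) ≤ N := by positivity
        linarith
    have e2 : exp (-(1 / 4)) ≤ exp (-‖y‖ ^ 2 / (4 * τ)) := by
      rw [exp_le_exp, ← hr, neg_div, neg_le_neg_iff, div_le_div_iff₀ (by positivity) (by norm_num)]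
      linarith
    have e3 : (2 : ℝ) ^ (-e) * (r + s) ^ (-e) ≤ (s + τ) ^ (-e) := by
      rw [← mul_rpow (by norm_num) (by positivity)]
      exact rpow_le_rpow_of_nonpos (by positivity) (by linarith) (by linarith)
    have e4 : r ^ κ * (2 * r)⁻¹ ≤ τ ^ (κ - 1) := by
      rw [rpow_sub_one hτ.ne', div_eq_mul_inv]
      gcongr
    have e5 : r ^ (-γ / 2) = r ^ (-(N : ℝ) / 2) * r ^ κ := by
      rw [← rpow_add hr0]; congr 1; rw [hκ]; ring
    calc c * (r ^ (-γ / 2) * (r + s) ^ (-e)) * r⁻¹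
        = ((8 * π) ^ (-(N : ℝ) / 2) * r ^ (-(N : ℝ) / 2)) * exp (-(1 / 4)) *
          (((2 : ℝ) ^ (-e) * (r + s) ^ (-e)) * (r ^ κ * (2 * r)⁻¹)) := by
          rw [e5, hc, mul_inv]; ring
      _ ≤ _ := by unfold heatKernel; gcongr
  rw [hyr]
  calc ENNReal.ofReal (r ^ (-γ / 2) * (r + s) ^ (-e))
      = ENNReal.ofReal c⁻¹ *
          ∫⁻ _ in Ioc r (2 * r), ENNReal.ofReal (c * (r ^ (-γ / 2) * (r + s) ^ (-e)) * r⁻¹) := by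
        rw [setLIntegral_const, volume_Ioc, ← ENNReal.ofReal_mul (by positivity),
          ← ENNReal.ofReal_mul (by positivity)]
        congr 1
        field_simp
        ring
    _ ≤ ENNReal.ofReal c⁻¹ * ∫⁻ τ in Ioc r (2 * r), ENNReal.ofReal (heatKernel N y τ) *
          ENNReal.ofReal ((s + τ) ^ (-e) * τ ^ (κ - 1)) := by
        gcongr 1
        refine setLIntegral_mono' measurableSet_Ioc fun τ hτ => ?_
        rw [← ENNReal.ofReal_mul (heatKernel_nonneg N y (hr0.trans hτ.1))]
        exact ENNReal.ofReal_le_ofReal (hpt τ hτ)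
    _ ≤ _ := by
        gcongr 1
        exact lintegral_mono_set fun τ hτ => hr0.trans hτ.1

lemma lintegral_Ioc_rpow {a : ℝ} (ha : -1 < a) {A : ℝ} (hA : 0 < A) :
    ∫⁻ τ in Ioc 0 A, ENNReal.ofReal (τ ^ a) = ENNReal.ofReal (A ^ (a + 1) / (a + 1)) := by
  have h1 : IntegrableOn (fun τ : ℝ => τ ^ a) (Ioc 0 A) :=
    (intervalIntegrable_iff_integrableOn_Ioc_of_le hA.le).1
      (intervalIntegral.intervalIntegrable_rpow' ha)
  rw [← ofReal_integral_eq_lintegral_ofReal h1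
    ((ae_restrict_iff' measurableSet_Ioc).2 (ae_of_all _ fun τ hτ => rpow_nonneg hτ.1.le a)),
    ← intervalIntegral.integral_of_le hA.le, integral_rpow (Or.inl ha),
    zero_rpow (by linarith), sub_zero]

lemma lintegral_Ioi_rpow {a : ℝ} (ha : a < -1) {A : ℝ} (hA : 0 < A) :
    ∫⁻ τ in Ioi A, ENNReal.ofReal (τ ^ a) = ENNReal.ofReal (-A ^ (a + 1) / (a + 1)) := by
  rw [← ofReal_integral_eq_lintegral_ofReal (integrableOn_Ioi_rpow_of_lt ha hA)
    ((ae_restrict_iff' measurableSet_Ioi).2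
      (ae_of_all _ fun τ hτ => rpow_nonneg (hA.trans hτ).le a)),
    integral_Ioi_rpow_of_lt ha hA]

lemma lintegral_add_rpow_mul_rpow_le {k n : ℝ} (hk : 0 < k) (hkn : k < n) {A : ℝ} (hA : 0 < A) :
    ∫⁻ τ in Ioi 0, ENNReal.ofReal ((A + τ) ^ (-n) * τ ^ (k - 1)) ≤
      ENNReal.ofReal ((1 / k + 1 / (n - k)) * A ^ (k - n)) := by
  have hnk : 0 < n - k := sub_pos.2 hkn
  rw [← Ioc_union_Ioi_eq_Ioi hA.le,
    lintegral_union measurableSet_Ioi (Ioc_disjoint_Ioi le_rfl)]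
  have h1 : ∫⁻ τ in Ioc 0 A, ENNReal.ofReal ((A + τ) ^ (-n) * τ ^ (k - 1)) ≤
      ENNReal.ofReal (1 / k * A ^ (k - n)) := by
    calc _ ≤ ∫⁻ τ in Ioc 0 A, ENNReal.ofReal (A ^ (-n)) * ENNReal.ofReal (τ ^ (k - 1)) := by
          refine setLIntegral_mono' measurableSet_Ioc fun τ hτ => ?_
          rw [← ENNReal.ofReal_mul (by positivity)]
          refine ENNReal.ofReal_le_ofReal (mul_le_mul_of_nonneg_right ?_ (rpow_nonneg hτ.1.le _))
          exact rpow_le_rpow_of_nonpos hA (by linarith [hτ.1]) (by linarith)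
      _ = ENNReal.ofReal (1 / k * A ^ (k - n)) := by
          rw [lintegral_const_mul _ (by fun_prop), lintegral_Ioc_rpow (by linarith) hA,
            ← ENNReal.ofReal_mul (by positivity), sub_add_cancel, sub_eq_add_neg k n, rpow_add hA]
          congr 1
          ring
  have h2 : ∫⁻ τ in Ioi A, ENNReal.ofReal ((A + τ) ^ (-n) * τ ^ (k - 1)) ≤
      ENNReal.ofReal (1 / (n - k) * A ^ (k - n)) := by
    calc _ ≤ ∫⁻ τ in Ioi A, ENNReal.ofReal (τ ^ (k - n - 1)) := by
          refine setLIntegral_mono' measurableSet_Ioi fun τ hτ => ENNReal.ofReal_le_ofReal ?_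
          have hτ0 : 0 < τ := hA.trans hτ
          rw [show k - n - 1 = -n + (k - 1) by ring, rpow_add hτ0]
          refine mul_le_mul_of_nonneg_right ?_ (by positivity)
          exact rpow_le_rpow_of_nonpos hτ0 (by linarith) (by linarith)
      _ = ENNReal.ofReal (1 / (n - k) * A ^ (k - n)) := by
          rw [lintegral_Ioi_rpow (by linarith) hA, sub_add_cancel]
          congr 1
          rw [← neg_sub n k, div_neg, neg_div, neg_neg]
          ring
  refine (add_le_add h1 h2).trans_eq ?_
  rw [← ENNReal.ofReal_add (by positivity) (by positivity), add_mul]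

lemma lintegral_lintegral_rpow_le {e κ l : ℝ} (he : 0 < e) (hκ : 0 < κ) (heκ : e < 1 + κ)
    (hl : κ - e + 1 ≤ l) :
    ∃ C : ℝ, 0 < C ∧ ∀ A : ℝ, 0 < A →
      ∫⁻ s in Ioo 0 A, ∫⁻ τ in Ioi 0,
        ENNReal.ofReal ((s + τ) ^ (-e) * ((A + τ) ^ (-l) * τ ^ (κ - 1))) ≤
      ENNReal.ofReal (C * A ^ (1 - e + κ - l)) := by
  obtain ⟨α, hα1, hα2⟩ : ∃ α, max 0 (e - κ) < α ∧ α < min 1 e :=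
    exists_between (max_lt (lt_min one_pos he) (lt_min (by linarith) (by linarith)))
  obtain ⟨hα0, hακ⟩ := max_lt_iff.1 hα1
  obtain ⟨hα1', hαe⟩ := lt_min_iff.1 hα2
  set k := κ - e + α with hk
  have hk0 : 0 < k := by rw [hk]; linarith
  have hkl : k < l := by rw [hk]; linarith
  have hlk : 0 < l - k := by linarith
  have hα : 0 < 1 - α := by linarith
  refine ⟨1 / (1 - α) * (1 / k + 1 / (l - k)), by positivity, fun A hA => ?_⟩
  calc _ ≤ ∫⁻ s in Ioo 0 A, ENNReal.ofReal (s ^ (-α)) *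
        ∫⁻ τ in Ioi 0, ENNReal.ofReal ((A + τ) ^ (-l) * τ ^ (k - 1)) := by
        refine setLIntegral_mono' measurableSet_Ioo fun s hs => ?_
        rw [← lintegral_const_mul _ (by fun_prop)]
        refine setLIntegral_mono' measurableSet_Ioi fun τ (hτ : 0 < τ) => ?_
        have hs0 : 0 < s := hs.1
        rw [← ENNReal.ofReal_mul (by positivity)]
        refine ENNReal.ofReal_le_ofReal ?_
        have h1 : (s + τ) ^ (-e) ≤ s ^ (-α) * τ ^ (α - e) := by
          rw [show -e = -α + (α - e) by ring, rpow_add (by positivity)]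
          gcongr ?_ * ?_
          · exact rpow_le_rpow_of_nonpos hs0 (by linarith) (by linarith)
          · exact rpow_le_rpow_of_nonpos hτ (by linarith) (by linarith)
        have h2 : τ ^ (k - 1) = τ ^ (α - e) * τ ^ (κ - 1) := by
          rw [← rpow_add hτ]; congr 1; rw [hk]; ring
        calc _ ≤ s ^ (-α) * τ ^ (α - e) * ((A + τ) ^ (-l) * τ ^ (κ - 1)) := by gcongr
          _ = _ := by rw [h2]; ring
    _ = (∫⁻ s in Ioo 0 A, ENNReal.ofReal (s ^ (-α))) *
        ∫⁻ τ in Ioi 0, ENNReal.ofReal ((A + τ) ^ (-l) * τ ^ (k - 1)) :=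
        lintegral_mul_const _ (by fun_prop)
    _ ≤ ENNReal.ofReal (A ^ (-α + 1) / (-α + 1)) *
        ENNReal.ofReal ((1 / k + 1 / (l - k)) * A ^ (k - l)) := by
        gcongr
        · rw [← lintegral_Ioc_rpow (by linarith) hA]
          exact lintegral_mono_set Ioo_subset_Ioc_self
        · exact lintegral_add_rpow_mul_rpow_le hk0 hkl hA
    _ = _ := by
        have h3 : 0 < -α + 1 := by linarith
        have h4 : A ^ (1 - e + κ - l) = A ^ (-α + 1) * A ^ (k - l) := by
          rw [← rpow_add hA]; congr 1; rw [hk]; ring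
        rw [← ENNReal.ofReal_mul (by positivity), h4, show 1 - α = -α + 1 by ring]
        congr 1
        ring

lemma lintegral_lintegral_rpow_reflect_le {n e κ : ℝ} (hn : 0 < n) (he : 0 < e) (hκ : 0 < κ)
    (heκ : e < 1 + κ) (hnκ : n < 1 + κ) (hen : κ + 1 ≤ n + e) :
    ∃ C : ℝ, 0 < C ∧ ∀ A : ℝ, 0 < A →
      ∫⁻ s in Ioo 0 A, ∫⁻ τ in Ioi 0,
        ENNReal.ofReal ((A - s + τ) ^ (-n) * ((s + τ) ^ (-e) * τ ^ (κ - 1))) ≤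
      ENNReal.ofReal (C * A ^ (1 - e + κ - n)) := by
  obtain ⟨C₁, hC₁, H₁⟩ := lintegral_lintegral_rpow_le he hκ heκ (l := n) (by linarith)
  obtain ⟨C₂, hC₂, H₂⟩ := lintegral_lintegral_rpow_le hn hκ hnκ (l := e) (by linarith)
  refine ⟨2 ^ n * C₁ + 2 ^ e * C₂, by positivity, fun A hA => ?_⟩
  have half_le {d x y : ℝ} (hd : 0 < d) (hx : 0 < x) (hxy : y ≤ 2 * x) (hy : 0 < y) :
      x ^ (-d) ≤ 2 ^ d * y ^ (-d) := by
    calc x ^ (-d) ≤ (y / 2) ^ (-d) :=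
          rpow_le_rpow_of_nonpos (by positivity) (by linarith) (by linarith)
      _ = 2 ^ d * y ^ (-d) := by
          rw [div_rpow hy.le (by norm_num), rpow_neg (by norm_num : (0 : ℝ) ≤ 2), div_inv_eq_mul,
            mul_comm]
  have hreflect : ∫⁻ s in Ioo 0 A, ∫⁻ τ in Ioi 0,
        ENNReal.ofReal ((A - s + τ) ^ (-n) * ((A + τ) ^ (-e) * τ ^ (κ - 1))) =
      ∫⁻ s in Ioo 0 A, ∫⁻ τ in Ioi 0,
        ENNReal.ofReal ((s + τ) ^ (-n) * ((A + τ) ^ (-e) * τ ^ (κ - 1))) := by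
    rw [← lintegral_indicator measurableSet_Ioo, ← lintegral_indicator measurableSet_Ioo,
      ← lintegral_sub_left_eq_self _ A]
    refine lintegral_congr fun s => ?_
    by_cases hs : s ∈ Ioo 0 A
    · have hs' : A - s ∈ Ioo 0 A := ⟨by linarith [hs.2], by linarith [hs.1]⟩
      rw [indicator_of_mem hs, indicator_of_mem hs', sub_sub_cancel]
    · have hs' : A - s ∉ Ioo 0 A := fun h => hs ⟨by linarith [h.2], by linarith [h.1]⟩
      rw [indicator_of_notMem hs, indicator_of_notMem hs']
  calc _ ≤ ∫⁻ s in Ioo 0 A, (ENNReal.ofReal (2 ^ n) * (∫⁻ τ in Ioi 0,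
          ENNReal.ofReal ((s + τ) ^ (-e) * ((A + τ) ^ (-n) * τ ^ (κ - 1)))) +
        ENNReal.ofReal (2 ^ e) * ∫⁻ τ in Ioi 0,
          ENNReal.ofReal ((A - s + τ) ^ (-n) * ((A + τ) ^ (-e) * τ ^ (κ - 1)))) := by
        refine setLIntegral_mono' measurableSet_Ioo fun s hs => ?_
        rw [← lintegral_const_mul _ (by fun_prop), ← lintegral_const_mul _ (by fun_prop),
          ← lintegral_add_left (by fun_prop)]
        refine setLIntegral_mono' measurableSet_Ioi fun τ (hτ : 0 < τ) => ?_
        have hs0 : 0 < s := hs.1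
        have hsA : 0 < A - s := by linarith [hs.2]
        rw [← ENNReal.ofReal_mul (by positivity), ← ENNReal.ofReal_mul (by positivity),
          ← ENNReal.ofReal_add (by positivity) (by positivity)]
        refine ENNReal.ofReal_le_ofReal ?_
        rcases le_total s (A / 2) with h | h
        · have h1 : (A - s + τ) ^ (-n) ≤ 2 ^ n * (A + τ) ^ (-n) :=
            half_le hn (by positivity) (by linarith) (by positivity)
          calc _ ≤ 2 ^ n * (A + τ) ^ (-n) * ((s + τ) ^ (-e) * τ ^ (κ - 1)) := by gcongr
            _ = 2 ^ n * ((s + τ) ^ (-e) * ((A + τ) ^ (-n) * τ ^ (κ - 1))) := by ring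
            _ ≤ _ := le_add_of_nonneg_right (by positivity)
        · have h1 : (s + τ) ^ (-e) ≤ 2 ^ e * (A + τ) ^ (-e) :=
            half_le he (by positivity) (by linarith) (by positivity)
          calc _ ≤ (A - s + τ) ^ (-n) * (2 ^ e * (A + τ) ^ (-e) * τ ^ (κ - 1)) := by gcongr
            _ = 2 ^ e * ((A - s + τ) ^ (-n) * ((A + τ) ^ (-e) * τ ^ (κ - 1))) := by ring
            _ ≤ _ := le_add_of_nonneg_left (by positivity)
    _ = ENNReal.ofReal (2 ^ n) * (∫⁻ s in Ioo 0 A, ∫⁻ τ in Ioi 0,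
          ENNReal.ofReal ((s + τ) ^ (-e) * ((A + τ) ^ (-n) * τ ^ (κ - 1)))) +
        ENNReal.ofReal (2 ^ e) * ∫⁻ s in Ioo 0 A, ∫⁻ τ in Ioi 0,
          ENNReal.ofReal ((A - s + τ) ^ (-n) * ((A + τ) ^ (-e) * τ ^ (κ - 1))) := by
        have m₁ : Measurable fun s : ℝ => ∫⁻ τ in Ioi 0,
            ENNReal.ofReal ((s + τ) ^ (-e) * ((A + τ) ^ (-n) * τ ^ (κ - 1))) :=
          Measurable.lintegral_prod_right' (f := fun q : ℝ × ℝ =>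
            ENNReal.ofReal ((q.1 + q.2) ^ (-e) * ((A + q.2) ^ (-n) * q.2 ^ (κ - 1)))) (by fun_prop)
        have m₂ : Measurable fun s : ℝ => ∫⁻ τ in Ioi 0,
            ENNReal.ofReal ((A - s + τ) ^ (-n) * ((A + τ) ^ (-e) * τ ^ (κ - 1))) :=
          Measurable.lintegral_prod_right' (f := fun q : ℝ × ℝ =>
            ENNReal.ofReal ((A - q.1 + q.2) ^ (-n) * ((A + q.2) ^ (-e) * q.2 ^ (κ - 1))))
            (by fun_prop)
        rw [lintegral_add_left (m₁.const_mul _), lintegral_const_mul _ m₁,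
          lintegral_const_mul _ m₂]
    _ ≤ ENNReal.ofReal (2 ^ n) * ENNReal.ofReal (C₁ * A ^ (1 - e + κ - n)) +
        ENNReal.ofReal (2 ^ e) * ENNReal.ofReal (C₂ * A ^ (1 - n + κ - e)) := by
        rw [hreflect]
        gcongr
        · exact H₁ A hA
        · exact H₂ A hA
    _ = _ := by
        rw [← ENNReal.ofReal_mul (by positivity), ← ENNReal.ofReal_mul (by positivity),
          ← ENNReal.ofReal_add (by positivity) (by positivity),
          show 1 - n + κ - e = 1 - e + κ - n by ring]
        congr 1
        ring

lemma lintegral_heatKernel_mul_rpow_mul_rpow_le (N : ℕ) (hN : 1 ≤ N) {γ e : ℝ} (hγ : γ < N)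
    (he : 0 ≤ e) :
    ∃ C : ℝ, 0 < C ∧ ∀ (x : EuclideanSpace ℝ (Fin N)) (t s : ℝ), 0 < t → 0 ≤ s →
      ∫⁻ y, ENNReal.ofReal (heatKernel N (x - y) t) *
          ENNReal.ofReal (‖y‖ ^ (-γ) * (‖y‖ ^ 2 + s) ^ (-e)) ≤
        ENNReal.ofReal C * ∫⁻ τ in Ioi 0, ENNReal.ofReal ((‖x‖ ^ 2 + t + τ) ^ (-((N : ℝ) / 2)) *
          ((s + τ) ^ (-e) * τ ^ (((N : ℝ) - γ) / 2 - 1))) := by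
  obtain ⟨C₁, hC₁, H₁⟩ := exists_rpow_le_mixture N hγ he
  obtain ⟨C₂, hC₂, H₂⟩ := heatKernel_le_rpow N hN
  have : Nonempty (Fin N) := ⟨⟨0, hN⟩⟩
  have hne : ∀ᵐ y : EuclideanSpace ℝ (Fin N), y ≠ 0 := compl_mem_ae_iff.2 (measure_singleton 0)
  refine ⟨C₁ * C₂, by positivity, fun x t s ht hs => ?_⟩
  calc _ ≤ ∫⁻ y, ENNReal.ofReal C₁ * (ENNReal.ofReal (heatKernel N (x - y) t) *
          ∫⁻ τ in Ioi 0, ENNReal.ofReal (heatKernel N y τ) *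
            ENNReal.ofReal ((s + τ) ^ (-e) * τ ^ (((N : ℝ) - γ) / 2 - 1))) := by
        refine lintegral_mono_ae ?_
        filter_upwards [hne] with y hy
        rw [mul_left_comm]
        gcongr
        exact H₁ y s hy hs
    _ = ENNReal.ofReal C₁ * ∫⁻ τ in Ioi 0, ENNReal.ofReal (heatKernel N x (t + τ)) *
            ENNReal.ofReal ((s + τ) ^ (-e) * τ ^ (((N : ℝ) - γ) / 2 - 1)) := by
        rw [lintegral_const_mul' _ _ ENNReal.ofReal_ne_top,
          lintegral_heatKernel_mul_mixture N x ht (by fun_prop)]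
    _ ≤ ENNReal.ofReal C₁ * ∫⁻ τ in Ioi 0, ENNReal.ofReal C₂ *
          ENNReal.ofReal ((‖x‖ ^ 2 + t + τ) ^ (-((N : ℝ) / 2)) *
            ((s + τ) ^ (-e) * τ ^ (((N : ℝ) - γ) / 2 - 1))) := by
        gcongr 1
        refine setLIntegral_mono' measurableSet_Ioi fun τ (hτ : 0 < τ) => ?_
        have h := H₂ x (t + τ) (by positivity)
        rw [← ENNReal.ofReal_mul (heatKernel_nonneg N x (by positivity)),
          ← ENNReal.ofReal_mul hC₂.le, ← mul_assoc C₂, add_assoc (‖x‖ ^ 2), ← neg_div]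
        exact ENNReal.ofReal_le_ofReal (mul_le_mul_of_nonneg_right h (by positivity))
    _ = _ := by
        rw [lintegral_const_mul' _ _ ENNReal.ofReal_ne_top, ENNReal.ofReal_mul hC₁.le, mul_assoc]

/-- Decay of the heat semigroup applied to `‖y‖ ^ (-a)`. -/
lemma lintegral_heatKernel_mul_rpow_le (N : ℕ) (hN : 1 ≤ N) {a : ℝ} (ha : 0 < a) (haN : a < N) :
    ∃ C : ℝ, 0 < C ∧ ∀ (x : EuclideanSpace ℝ (Fin N)) (t : ℝ), 0 < t →
      ∫⁻ y, ENNReal.ofReal (heatKernel N (x - y) t) * ENNReal.ofReal (‖y‖ ^ (-a)) ≤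
        ENNReal.ofReal (C * (‖x‖ ^ 2 + t) ^ (-(a / 2))) := by
  obtain ⟨C, hC, H⟩ := lintegral_heatKernel_mul_rpow_mul_rpow_le N hN haN le_rfl
  set k : ℝ := ((N : ℝ) - a) / 2 with hk
  have hk0 : 0 < k := by rw [hk]; linarith
  have hkN : k < (N : ℝ) / 2 := by rw [hk]; linarith
  have hd : 0 < (N : ℝ) / 2 - k := sub_pos.2 hkN
  refine ⟨C * (1 / k + 1 / ((N : ℝ) / 2 - k)), by positivity, fun x t ht => ?_⟩
  have h := H x t 0 ht le_rfl
  simp only [neg_zero, rpow_zero, mul_one, one_mul] at h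
  refine h.trans ?_
  rw [mul_assoc, ENNReal.ofReal_mul hC.le,
    show -(a / 2) = k - (N : ℝ) / 2 by rw [hk]; ring]
  gcongr
  exact lintegral_add_rpow_mul_rpow_le hk0 hkN (by positivity)

/-- The Duhamel term with source `F`. -/
noncomputable def duhamel (N : ℕ) (F : EuclideanSpace ℝ (Fin N) → ℝ → ℝ≥0∞)
    (x : EuclideanSpace ℝ (Fin N)) (t : ℝ) : ℝ≥0∞ :=
  ∫⁻ s in Ioo 0 t, ∫⁻ y, ENNReal.ofReal (heatKernel N (x - y) (t - s)) * F y s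

section duhamel

variable {N : ℕ} {F G : EuclideanSpace ℝ (Fin N) → ℝ → ℝ≥0∞}

lemma duhamel_mono (h : ∀ y s, 0 < s → F y s ≤ G y s) (x : EuclideanSpace ℝ (Fin N)) (t : ℝ) :
    duhamel N F x t ≤ duhamel N G x t :=
  setLIntegral_mono' measurableSet_Ioo fun s hs =>
    lintegral_mono fun y => mul_le_mul_right (h y s hs.1) _

lemma duhamel_const_mul {c : ℝ≥0∞} (hc : c ≠ ∞) (x : EuclideanSpace ℝ (Fin N)) (t : ℝ) :
    duhamel N (fun y s => c * F y s) x t = c * duhamel N F x t := by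
  unfold duhamel
  rw [← lintegral_const_mul' _ _ hc]
  refine lintegral_congr fun s => ?_
  rw [← lintegral_const_mul' _ _ hc]
  exact lintegral_congr fun y => mul_left_comm _ _ _

lemma duhamel_sub (z x : EuclideanSpace ℝ (Fin N)) (t : ℝ) :
    duhamel N (fun y s => F (y - z) s) x t = duhamel N F (x - z) t := by
  unfold duhamel
  refine lintegral_congr fun s => ?_
  rw [← lintegral_sub_right_eq_self
    (fun y => ENNReal.ofReal (heatKernel N (x - z - y) (t - s)) * F y s) z]
  refine lintegral_congr fun y => ?_
  rw [sub_sub_sub_cancel_right]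

lemma duhamel_add_time_le {r : ℝ} (hr : 0 ≤ r) (x : EuclideanSpace ℝ (Fin N)) (t : ℝ) :
    duhamel N (fun y s => F y (s + r)) x t ≤ duhamel N F x (t + r) := by
  unfold duhamel
  rw [← lintegral_indicator measurableSet_Ioo, ← lintegral_indicator measurableSet_Ioo]
  refine (lintegral_mono fun s => ?_).trans_eq (lintegral_add_right_eq_self _ r)
  by_cases hs : s ∈ Ioo 0 t
  · have hs' : s + r ∈ Ioo 0 (t + r) := ⟨by linarith [hs.1], by linarith [hs.2]⟩
    rw [indicator_of_mem hs, indicator_of_mem hs', add_sub_add_right_eq_sub]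
  · rw [indicator_of_notMem hs]
    exact zero_le

lemma measurable_heatKernel_mul (hF : Measurable (Function.uncurry F)) :
    Measurable fun q : ((EuclideanSpace ℝ (Fin N) × ℝ) × ℝ) × EuclideanSpace ℝ (Fin N) =>
      ENNReal.ofReal (heatKernel N (q.1.1.1 - q.2) (q.1.1.2 - q.1.2)) * F q.2 q.1.2 :=
  ((measurable_heatKernel N).comp
    (f := fun q : ((EuclideanSpace ℝ (Fin N) × ℝ) × ℝ) × EuclideanSpace ℝ (Fin N) =>
      (q.1.1.1 - q.2, q.1.1.2 - q.1.2)) (by fun_prop)).ennreal_ofReal.mul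
    (hF.comp (f := fun q : ((EuclideanSpace ℝ (Fin N) × ℝ) × ℝ) × EuclideanSpace ℝ (Fin N) =>
      (q.2, q.1.2)) (by fun_prop))

lemma measurable_duhamel_slice (hF : Measurable (Function.uncurry F)) :
    Measurable fun q : (EuclideanSpace ℝ (Fin N) × ℝ) × ℝ =>
      ∫⁻ y, ENNReal.ofReal (heatKernel N (q.1.1 - y) (q.1.2 - q.2)) * F y q.2 :=
  (measurable_heatKernel_mul hF).lintegral_prod_right'

lemma measurable_duhamel_slice_time (hF : Measurable (Function.uncurry F))
    (x : EuclideanSpace ℝ (Fin N)) (t : ℝ) :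
    Measurable fun s : ℝ => ∫⁻ y, ENNReal.ofReal (heatKernel N (x - y) (t - s)) * F y s :=
  (measurable_duhamel_slice hF).comp (g := fun q : (EuclideanSpace ℝ (Fin N) × ℝ) × ℝ =>
      ∫⁻ y, ENNReal.ofReal (heatKernel N (q.1.1 - y) (q.1.2 - q.2)) * F y q.2)
    (f := fun s : ℝ => ((x, t), s)) (by fun_prop)

lemma measurable_heatKernel_mul_space (hF : Measurable (Function.uncurry F))
    (x : EuclideanSpace ℝ (Fin N)) (t s : ℝ) :
    Measurable fun y => ENNReal.ofReal (heatKernel N (x - y) (t - s)) * F y s :=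
  (measurable_heatKernel_mul hF).comp
    (g := fun q : ((EuclideanSpace ℝ (Fin N) × ℝ) × ℝ) × EuclideanSpace ℝ (Fin N) =>
      ENNReal.ofReal (heatKernel N (q.1.1.1 - q.2) (q.1.1.2 - q.1.2)) * F q.2 q.1.2)
    (f := fun y : EuclideanSpace ℝ (Fin N) => (((x, t), s), y)) (by fun_prop)

lemma measurable_duhamel (hF : Measurable (Function.uncurry F)) :
    Measurable (Function.uncurry (duhamel N F)) := by
  have h : Function.uncurry (duhamel N F) = fun q : EuclideanSpace ℝ (Fin N) × ℝ =>
      ∫⁻ s, {r : (EuclideanSpace ℝ (Fin N) × ℝ) × ℝ | 0 < r.2 ∧ r.2 < r.1.2}.indicator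
        (fun r => ∫⁻ y, ENNReal.ofReal (heatKernel N (r.1.1 - y) (r.1.2 - r.2)) * F y r.2)
        (q, s) := by
    funext q
    rw [Function.uncurry, duhamel, ← lintegral_indicator measurableSet_Ioo]
    rfl
  rw [h]
  refine Measurable.lintegral_prod_right' ((measurable_duhamel_slice hF).indicator ?_)
  exact (measurableSet_lt measurable_const measurable_snd).inter
    (measurableSet_lt measurable_snd (by fun_prop))

lemma duhamel_add (hF : Measurable (Function.uncurry F)) (x : EuclideanSpace ℝ (Fin N)) (t : ℝ) :
    duhamel N (fun y s => F y s + G y s) x t = duhamel N F x t + duhamel N G x t := by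
  unfold duhamel
  rw [← lintegral_add_left (measurable_duhamel_slice_time hF x t)]
  refine lintegral_congr fun s => ?_
  rw [← lintegral_add_left (measurable_heatKernel_mul_space hF x t s)]
  exact lintegral_congr fun y => mul_add _ _ _

lemma duhamel_iSup {f : ℕ → EuclideanSpace ℝ (Fin N) → ℝ → ℝ≥0∞}
    (hf : ∀ n, Measurable (Function.uncurry (f n))) (hmono : Monotone f)
    (x : EuclideanSpace ℝ (Fin N)) (t : ℝ) :
    duhamel N (fun y s => ⨆ n, f n y s) x t = ⨆ n, duhamel N (f n) x t := by
  unfold duhamel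
  rw [← lintegral_iSup (fun n => measurable_duhamel_slice_time (hf n) x t)
    fun m n hmn s => lintegral_mono fun y => mul_le_mul_right (hmono hmn y s) _]
  refine lintegral_congr fun s => ?_
  rw [← lintegral_iSup (fun n => measurable_heatKernel_mul_space (hf n) x t s)
    fun m n hmn y => mul_le_mul_right (hmono hmn y s) _]
  exact lintegral_congr fun y => ENNReal.mul_iSup _ _

/-- Monotone iteration below a supersolution. -/
lemma exists_mild_solution {p : ℝ} (hp : 0 < p) {w : EuclideanSpace ℝ (Fin N) → ℝ≥0∞}
    (hw : Measurable w) {I V : EuclideanSpace ℝ (Fin N) → ℝ → ℝ≥0∞}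
    (hI : Measurable (Function.uncurry I))
    (hV : ∀ x t, 0 < t → I x t + duhamel N (fun y s => w y * V y s ^ p) x t ≤ V x t) :
    ∃ u : EuclideanSpace ℝ (Fin N) → ℝ → ℝ≥0∞, Measurable (Function.uncurry u) ∧
      (∀ x t, 0 < t → u x t ≤ V x t) ∧
      ∀ x t, u x t = I x t + duhamel N (fun y s => w y * u y s ^ p) x t := by
  set Φ : (EuclideanSpace ℝ (Fin N) → ℝ → ℝ≥0∞) → EuclideanSpace ℝ (Fin N) → ℝ → ℝ≥0∞ :=
    fun v x t => I x t + duhamel N (fun y s => w y * v y s ^ p) x t with hΦ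
  have hpow_meas {v : EuclideanSpace ℝ (Fin N) → ℝ → ℝ≥0∞} (hv : Measurable (Function.uncurry v)) :
      Measurable (Function.uncurry fun y s => w y * v y s ^ p) :=
    (hw.comp measurable_fst).mul (hv.pow_const p)
  have hpow_mono {a b : ℝ≥0∞} (h : a ≤ b) (y : EuclideanSpace ℝ (Fin N)) :
      w y * a ^ p ≤ w y * b ^ p := by gcongr
  have hΦ_mono : Monotone Φ := fun v v' h x t =>
    add_le_add le_rfl (duhamel_mono (fun y s _ => hpow_mono (h y s) y) x t)
  set U : ℕ → EuclideanSpace ℝ (Fin N) → ℝ → ℝ≥0∞ := fun n => Φ^[n] 0 with hU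
  have hU_succ (n : ℕ) : U (n + 1) = Φ (U n) := Function.iterate_succ_apply' Φ n 0
  have hU_mono : Monotone U :=
    hΦ_mono.monotone_iterate_of_le_map fun x t => zero_le
  have hU_meas (n : ℕ) : Measurable (Function.uncurry (U n)) := by
    induction n with
    | zero => exact measurable_const
    | succ n ih =>
      rw [hU_succ]
      exact hI.add (measurable_duhamel (hpow_meas ih))
  have hU_le (n : ℕ) : ∀ x t, 0 < t → U n x t ≤ V x t := by
    induction n with
    | zero => exact fun x t _ => zero_le
    | succ n ih =>
      intro x t ht
      rw [hU_succ]
      exact (add_le_add le_rfl (duhamel_mono (fun y s hs => hpow_mono (ih y s hs) y) x t)).trans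
        (hV x t ht)
  refine ⟨fun x t => ⨆ n, U n x t, .iSup hU_meas, fun x t ht => iSup_le fun n => hU_le n x t ht,
    fun x t => ?_⟩
  have hsup (y : EuclideanSpace ℝ (Fin N)) (s : ℝ) :
      w y * (⨆ n, U n y s) ^ p = ⨆ n, w y * U n y s ^ p := by
    rw [← ENNReal.mul_iSup]
    congr 1
    exact (ENNReal.orderIsoRpow p hp).map_iSup _
  simp only [hsup]
  rw [duhamel_iSup (fun n => hpow_meas (hU_meas n))
    fun m n hmn y s => hpow_mono (hU_mono hmn y s) y, ENNReal.add_iSup,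
    ← Monotone.iSup_nat_add (fun m n hmn => hU_mono hmn x t) 1]
  exact iSup_congr fun n => by rw [hU_succ]

end duhamel

/-- Duhamel estimate for the scale-invariant source `‖y‖ ^ (-γ) * (‖y‖ ^ 2 + s) ^ (-e)`. -/
lemma duhamel_rpow_mul_rpow_le (N : ℕ) (hN : 1 ≤ N) {γ a : ℝ} (hγ2 : γ < 2)
    (hγN : γ < N) (ha : 0 < a) (haN : a < N) :
    ∃ C : ℝ, 0 < C ∧ ∀ (x : EuclideanSpace ℝ (Fin N)) (t : ℝ), 0 < t →
      duhamel N (fun y s => ENNReal.ofReal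
        (‖y‖ ^ (-γ) * (‖y‖ ^ 2 + s) ^ (-(1 + a / 2 - γ / 2)))) x t ≤
        ENNReal.ofReal (C * (‖x‖ ^ 2 + t) ^ (-(a / 2))) := by
  set e : ℝ := 1 + a / 2 - γ / 2 with he
  have he0 : 0 < e := by rw [he]; linarith
  set κ : ℝ := ((N : ℝ) - γ) / 2 with hκ
  have hκ0 : 0 < κ := by rw [hκ]; linarith
  obtain ⟨C₁, hC₁, H₁⟩ := lintegral_heatKernel_mul_rpow_mul_rpow_le N hN hγN he0.le
  obtain ⟨C₂, hC₂, H₂⟩ := lintegral_lintegral_rpow_reflect_le (n := (N : ℝ) / 2) (by linarith)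
    he0 hκ0 (by linarith) (by linarith) (by linarith)
  refine ⟨C₁ * C₂, by positivity, fun x t ht => ?_⟩
  have hA : 0 < ‖x‖ ^ 2 + t := by positivity
  calc duhamel N (fun y s => ENNReal.ofReal (‖y‖ ^ (-γ) * (‖y‖ ^ 2 + s) ^ (-e))) x t
      ≤ ∫⁻ s in Ioo 0 t, ENNReal.ofReal C₁ * ∫⁻ τ in Ioi 0,
        ENNReal.ofReal ((‖x‖ ^ 2 + t - s + τ) ^ (-((N : ℝ) / 2)) *
          ((s + τ) ^ (-e) * τ ^ (κ - 1))) := by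
        refine setLIntegral_mono' measurableSet_Ioo fun s hs => ?_
        rw [add_sub_assoc]
        exact H₁ x (t - s) s (by linarith [hs.2]) hs.1.le
    _ ≤ ∫⁻ s in Ioo 0 (‖x‖ ^ 2 + t), ENNReal.ofReal C₁ * ∫⁻ τ in Ioi 0,
        ENNReal.ofReal ((‖x‖ ^ 2 + t - s + τ) ^ (-((N : ℝ) / 2)) *
          ((s + τ) ^ (-e) * τ ^ (κ - 1))) :=
        lintegral_mono_set (Ioo_subset_Ioo_right (by linarith [sq_nonneg ‖x‖]))
    _ ≤ ENNReal.ofReal C₁ * ENNReal.ofReal (C₂ * (‖x‖ ^ 2 + t) ^ (1 - e + κ - (N : ℝ) / 2)) := by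
        rw [lintegral_const_mul' _ _ ENNReal.ofReal_ne_top]
        gcongr
        exact H₂ _ hA
    _ = _ := by
        rw [← ENNReal.ofReal_mul hC₁.le, mul_assoc]
        congr 4
        rw [he, hκ]
        ring

/-- The Hardy weight is comparable to `‖z‖ ^ (-γ)` away from the origin, while near the origin
`‖y - z‖` is comparable to `‖z‖`. -/
lemma hardy_mul_rpow_le {N : ℕ} {γ a s : ℝ} (hγ : 0 ≤ γ) (ha : 0 < a) (hs : 0 < s)
    {z : EuclideanSpace ℝ (Fin N)} (hz : z ≠ 0) (y : EuclideanSpace ℝ (Fin N)) :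
    ‖y‖ ^ (-γ) * (‖y - z‖ ^ 2 + s) ^ (-(1 + a / 2)) ≤
      (2 ^ γ + 8 ^ (1 + a / 2)) * ‖z‖ ^ (-γ) * ((‖y - z‖ ^ 2 + s) ^ (-(1 + a / 2)) +
        ‖y‖ ^ (-γ) * (‖y‖ ^ 2 + (s + ‖z‖ ^ 2)) ^ (-(1 + a / 2 - γ / 2))) := by
  have hR : 0 < ‖z‖ := norm_pos_iff.2 hz
  rcases le_or_gt (‖z‖ / 2) ‖y‖ with h | h
  · have h1 : ‖y‖ ^ (-γ) ≤ 2 ^ γ * ‖z‖ ^ (-γ) := by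
      calc ‖y‖ ^ (-γ) ≤ (‖z‖ / 2) ^ (-γ) :=
            rpow_le_rpow_of_nonpos (by positivity) h (by linarith)
        _ = 2 ^ γ * ‖z‖ ^ (-γ) := by
            rw [div_rpow hR.le (by norm_num), rpow_neg (by norm_num : (0 : ℝ) ≤ 2),
              div_inv_eq_mul, mul_comm]
    calc ‖y‖ ^ (-γ) * (‖y - z‖ ^ 2 + s) ^ (-(1 + a / 2))
        ≤ (2 ^ γ * ‖z‖ ^ (-γ)) * (‖y - z‖ ^ 2 + s) ^ (-(1 + a / 2)) := by gcongr
      _ ≤ _ := by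
        gcongr
        · exact le_add_of_nonneg_right (by positivity)
        · exact le_add_of_nonneg_right (by positivity)
  · set Q := ‖y‖ ^ 2 + (s + ‖z‖ ^ 2) with hQ
    have hQ0 : 0 < Q := by positivity
    have hyz : ‖z‖ / 2 ≤ ‖y - z‖ := by
      have := norm_sub_norm_le z y
      rw [norm_sub_rev] at this
      linarith
    have hQle : Q / 8 ≤ ‖y - z‖ ^ 2 + s := by
      have h1 : (‖z‖ / 2) ^ 2 ≤ ‖y - z‖ ^ 2 := by gcongr
      have h2 : ‖y‖ ^ 2 ≤ (‖z‖ / 2) ^ 2 := by gcongr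
      rw [hQ]
      nlinarith [sq_nonneg ‖z‖]
    have h1 : (‖y - z‖ ^ 2 + s) ^ (-(1 + a / 2)) ≤ 8 ^ (1 + a / 2) * Q ^ (-(1 + a / 2)) := by
      calc (‖y - z‖ ^ 2 + s) ^ (-(1 + a / 2)) ≤ (Q / 8) ^ (-(1 + a / 2)) :=
            rpow_le_rpow_of_nonpos (by positivity) hQle (by linarith)
        _ = _ := by
            rw [div_rpow hQ0.le (by norm_num), rpow_neg (by norm_num : (0 : ℝ) ≤ 8),
              div_inv_eq_mul, mul_comm]
    have h2 : Q ^ (-(1 + a / 2)) ≤ ‖z‖ ^ (-γ) * Q ^ (-(1 + a / 2 - γ / 2)) := by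
      rw [show -(1 + a / 2) = -(γ / 2) + -(1 + a / 2 - γ / 2) by ring, rpow_add hQ0]
      gcongr
      calc Q ^ (-(γ / 2)) ≤ (‖z‖ ^ 2) ^ (-(γ / 2)) :=
            rpow_le_rpow_of_nonpos (by positivity) (by rw [hQ]; nlinarith [sq_nonneg ‖y‖])
              (by linarith)
        _ = ‖z‖ ^ (-γ) := by
            rw [← rpow_natCast, ← rpow_mul hR.le]; congr 1; push_cast; ring
    calc ‖y‖ ^ (-γ) * (‖y - z‖ ^ 2 + s) ^ (-(1 + a / 2))
        ≤ ‖y‖ ^ (-γ) * (8 ^ (1 + a / 2) * (‖z‖ ^ (-γ) * Q ^ (-(1 + a / 2 - γ / 2)))) := by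
          gcongr
          exact h1.trans (by gcongr)
      _ = 8 ^ (1 + a / 2) * ‖z‖ ^ (-γ) * (‖y‖ ^ (-γ) * Q ^ (-(1 + a / 2 - γ / 2))) := by ring
      _ ≤ _ := by
        gcongr
        · exact le_add_of_nonneg_left (by positivity)
        · exact le_add_of_nonneg_left (by positivity)

lemma duhamel_hardy_le (N : ℕ) (hN : 1 ≤ N) {γ a : ℝ} (hγ0 : 0 ≤ γ) (hγ2 : γ < 2)
    (hγN : γ < N) (ha : 0 < a) (haN : a < N) :
    ∃ C : ℝ, 0 < C ∧ ∀ (z : EuclideanSpace ℝ (Fin N)), z ≠ 0 →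
      ∀ (x : EuclideanSpace ℝ (Fin N)) (t : ℝ), 0 < t →
      duhamel N (fun y s => ENNReal.ofReal
        (‖y‖ ^ (-γ) * (‖y - z‖ ^ 2 + s) ^ (-(1 + a / 2)))) x t ≤
        ENNReal.ofReal (C * ‖z‖ ^ (-γ) * (‖x - z‖ ^ 2 + t) ^ (-(a / 2))) := by
  obtain ⟨C₀, hC₀, H₀⟩ := duhamel_rpow_mul_rpow_le N hN (γ := 0) two_pos
    (by linarith) ha haN
  obtain ⟨C₁, hC₁, H₁⟩ := duhamel_rpow_mul_rpow_le N hN hγ2 hγN ha haN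
  simp only [neg_zero, rpow_zero, one_mul, zero_div, sub_zero] at H₀
  set D : ℝ := 2 ^ γ + 8 ^ (1 + a / 2) with hD
  have hD0 : 0 < D := by positivity
  refine ⟨D * (C₀ + C₁ * 2 ^ (a / 2)), by positivity, fun z hz x t ht => ?_⟩
  have hR : 0 < ‖z‖ := norm_pos_iff.2 hz
  set F₀ : EuclideanSpace ℝ (Fin N) → ℝ → ℝ≥0∞ := fun y s =>
    ENNReal.ofReal ((‖y‖ ^ 2 + s) ^ (-(1 + a / 2))) with hF₀
  set F₁ : EuclideanSpace ℝ (Fin N) → ℝ → ℝ≥0∞ := fun y s =>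
    ENNReal.ofReal (‖y‖ ^ (-γ) * (‖y‖ ^ 2 + s) ^ (-(1 + a / 2 - γ / 2))) with hF₁
  have hshift : (‖x‖ ^ 2 + (t + ‖z‖ ^ 2)) ^ (-(a / 2)) ≤
      2 ^ (a / 2) * (‖x - z‖ ^ 2 + t) ^ (-(a / 2)) := by
    calc (‖x‖ ^ 2 + (t + ‖z‖ ^ 2)) ^ (-(a / 2)) ≤ ((‖x - z‖ ^ 2 + t) / 2) ^ (-(a / 2)) := by
          refine rpow_le_rpow_of_nonpos (by positivity) ?_ (by linarith)
          have h1 : ‖x - z‖ ^ 2 ≤ (‖x‖ + ‖z‖) ^ 2 := by gcongr; exact norm_sub_le x z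
          nlinarith [sq_nonneg (‖x‖ - ‖z‖)]
      _ = _ := by
          rw [div_rpow (by positivity) (by norm_num), rpow_neg (by norm_num : (0 : ℝ) ≤ 2),
            div_inv_eq_mul, mul_comm]
  calc duhamel N (fun y s => ENNReal.ofReal
        (‖y‖ ^ (-γ) * (‖y - z‖ ^ 2 + s) ^ (-(1 + a / 2)))) x t
      ≤ duhamel N (fun y s => ENNReal.ofReal (D * ‖z‖ ^ (-γ)) *
          (F₀ (y - z) s + F₁ y (s + ‖z‖ ^ 2))) x t := by
        refine duhamel_mono (fun y s hs => ?_) x t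
        rw [hF₀, hF₁, ← ENNReal.ofReal_add (by positivity) (by positivity),
          ← ENNReal.ofReal_mul (by positivity)]
        exact ENNReal.ofReal_le_ofReal (hardy_mul_rpow_le hγ0 ha hs hz y)
    _ = ENNReal.ofReal (D * ‖z‖ ^ (-γ)) * (duhamel N F₀ (x - z) t +
          duhamel N (fun y s => F₁ y (s + ‖z‖ ^ 2)) x t) := by
        have hm : Measurable (Function.uncurry fun y s => F₀ (y - z) s) := by
          unfold Function.uncurry; fun_prop
        rw [duhamel_const_mul ENNReal.ofReal_ne_top, duhamel_add hm, duhamel_sub]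
    _ ≤ ENNReal.ofReal (D * ‖z‖ ^ (-γ)) *
          (ENNReal.ofReal (C₀ * (‖x - z‖ ^ 2 + t) ^ (-(a / 2))) +
            ENNReal.ofReal (C₁ * (‖x‖ ^ 2 + (t + ‖z‖ ^ 2)) ^ (-(a / 2)))) := by
        gcongr
        · exact H₀ (x - z) t ht
        · exact (duhamel_add_time_le (by positivity) x t).trans (H₁ x _ (by positivity))
    _ ≤ _ := by
        rw [← ENNReal.ofReal_add (by positivity) (by positivity),
          ← ENNReal.ofReal_mul (by positivity)]
        refine ENNReal.ofReal_le_ofReal ?_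
        calc _ ≤ D * ‖z‖ ^ (-γ) * (C₀ * (‖x - z‖ ^ 2 + t) ^ (-(a / 2)) +
              C₁ * (2 ^ (a / 2) * (‖x - z‖ ^ 2 + t) ^ (-(a / 2)))) := by gcongr
          _ = _ := by ring

/-- A finite extended-real mild solution gives a solution in the sense of `IsGlobalSol`. -/
lemma isGlobalSol_toReal {N : ℕ} {γ p : ℝ} (hp : 0 ≤ p) {u₀ : EuclideanSpace ℝ (Fin N) → ℝ}
    (hu₀ : Measurable u₀) (hu₀_nonneg : ∀ x, 0 ≤ u₀ x)
    {u : EuclideanSpace ℝ (Fin N) → ℝ → ℝ≥0∞} (hu : Measurable (Function.uncurry u))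
    (hfin : ∀ x t, 0 < t → u x t ≠ ∞)
    (hsol : ∀ x t, u x t =
      (∫⁻ y, ENNReal.ofReal (heatKernel N (x - y) t) * ENNReal.ofReal (u₀ y)) +
        duhamel N (fun y s => ENNReal.ofReal (‖y‖ ^ (-γ)) * u y s ^ p) x t) :
    IsGlobalSol N γ p u₀ fun x t => (u x t).toReal := by
  refine ⟨hu.ennreal_toReal, fun x t => ENNReal.toReal_nonneg, ae_of_all _ ?_⟩
  rintro ⟨x, t⟩ ht
  change 0 < t at ht
  dsimp only
  have hK (t : ℝ) : Measurable fun y => heatKernel N (x - y) t :=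
    (measurable_heatKernel N).comp (f := fun y : EuclideanSpace ℝ (Fin N) => (x - y, t))
      (by fun_prop)
  have hsum := hsol x t
  have hne := hfin x t ht
  rw [hsum, ENNReal.add_ne_top] at hne
  rw [hsum, ENNReal.toReal_add hne.1 hne.2]
  congr 1
  · rw [integral_eq_lintegral_of_nonneg_ae
      (ae_of_all _ fun y => mul_nonneg (heatKernel_nonneg N _ ht) (hu₀_nonneg y))
      ((hK t).mul hu₀).aestronglyMeasurable]
    congr 1
    exact lintegral_congr fun y => (ENNReal.ofReal_mul (heatKernel_nonneg N _ ht)).symm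
  · have hF : Measurable (Function.uncurry fun y s => ENNReal.ofReal (‖y‖ ^ (-γ)) * u y s ^ p) := by
      refine Measurable.mul (f := fun q : EuclideanSpace ℝ (Fin N) × ℝ =>
        ENNReal.ofReal (‖q.1‖ ^ (-γ))) (by fun_prop) (hu.pow_const p)
    have hm := measurable_duhamel_slice_time hF x t
    rw [duhamel, ← integral_toReal hm.aemeasurable (ae_lt_top hm hne.2)]
    refine setIntegral_congr_fun measurableSet_Ioo fun s hs => ?_
    have hts : 0 < t - s := sub_pos.2 hs.2
    rw [integral_eq_lintegral_of_nonneg_ae]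
    · congr 1
      refine lintegral_congr fun y => ?_
      have hw : 0 ≤ ‖y‖ ^ (-γ) := by positivity
      rw [mul_assoc, ENNReal.ofReal_mul (heatKernel_nonneg N _ hts), ENNReal.ofReal_mul hw,
        ← ENNReal.ofReal_rpow_of_nonneg ENNReal.toReal_nonneg hp,
        ENNReal.ofReal_toReal (hfin y s hs.1)]
    · exact ae_of_all _ fun y => mul_nonneg (mul_nonneg (heatKernel_nonneg N _ hts) (by positivity))
        (by positivity)
    · have hus : Measurable fun y => u y s :=
        hu.comp (f := fun y : EuclideanSpace ℝ (Fin N) => (y, s)) (by fun_prop)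
      exact (((hK (t - s)).mul (by fun_prop)).mul
        (hus.ennreal_toReal.pow_const p)).aestronglyMeasurable

theorem statement1 (N : ℕ) (hN : 1 ≤ N) (γ p : ℝ)
    (hγ0 : 0 < γ) (hγ : γ < min 2 (N : ℝ)) (hp : 1 + 2 / (N : ℝ) < p) :
    ∃ cstar : ℝ, 0 < cstar ∧
      ∀ (z : EuclideanSpace ℝ (Fin N)), z ≠ 0 →
      ∀ (u₀ : EuclideanSpace ℝ (Fin N) → ℝ) (c : ℝ),
        Measurable u₀ → (∀ x, 0 ≤ u₀ x) →
        0 < c → c ≤ cstar →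
        (∀ x, x ≠ z →
          u₀ x ≤ c * ‖z‖ ^ (γ / (p - 1)) * ‖x - z‖ ^ (-2 / (p - 1))) →
        ∃ u, IsGlobalSol N γ p u₀ u := by
  obtain ⟨hγ2, hγN⟩ := lt_min_iff.1 hγ
  have hN0 : (0 : ℝ) < N := by exact_mod_cast hN
  have hp1 : 0 < p - 1 := by
    have : 0 < 2 / (N : ℝ) := by positivity
    linarith
  have hp0 : 0 < p := by linarith
  set a : ℝ := 2 / (p - 1) with ha
  have ha0 : 0 < a := by positivity
  have haN : a < N := by
    rw [ha, div_lt_iff₀ hp1, ← div_lt_iff₀' hN0]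
    linarith
  have hap : a / 2 * p = 1 + a / 2 := by rw [ha]; field_simp; ring
  obtain ⟨C₁, hC₁, H₁⟩ := lintegral_heatKernel_mul_rpow_le N hN ha0 haN
  obtain ⟨C₂, hC₂, H₂⟩ := duhamel_hardy_le N hN hγ0.le hγ2 hγN ha0 haN
  have hB : 0 < C₁ / (C₂ * (2 * C₁) ^ p) := by positivity
  refine ⟨(C₁ / (C₂ * (2 * C₁) ^ p)) ^ (1 / (p - 1)), by positivity, ?_⟩
  intro z hz u₀ c hu₀ hu₀_nonneg hc hcstar hbound
  have hR : 0 < ‖z‖ := norm_pos_iff.2 hz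
  set b : ℝ := ‖z‖ ^ (γ / (p - 1)) with hb
  have hb0 : 0 < b := by positivity
  have hbp : b ^ p * ‖z‖ ^ (-γ) = b := by
    rw [hb, ← rpow_mul hR.le, ← rpow_add hR]
    congr 1
    field_simp
    ring
  set M : ℝ := 2 * C₁ * c * b with hM
  have hM0 : 0 < M := by positivity
  have hsmall : C₂ * M ^ p * ‖z‖ ^ (-γ) ≤ C₁ * c * b := by
    have h1 : c ^ (p - 1) ≤ C₁ / (C₂ * (2 * C₁) ^ p) := by
      refine (rpow_le_rpow hc.le hcstar hp1.le).trans_eq ?_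
      rw [← rpow_mul hB.le, one_div_mul_cancel hp1.ne', rpow_one]
    have h2 : c ^ p = c ^ (p - 1) * c := by
      rw [← rpow_add_one hc.ne', sub_add_cancel]
    rw [le_div_iff₀ (by positivity)] at h1
    calc C₂ * M ^ p * ‖z‖ ^ (-γ)
        = c ^ (p - 1) * (C₂ * (2 * C₁) ^ p) * c * (b ^ p * ‖z‖ ^ (-γ)) := by
          rw [hM, mul_rpow (by positivity) hb0.le, mul_rpow (by positivity) hc.le, h2]; ring
      _ ≤ C₁ * c * b := by rw [hbp]; gcongr
  set V : EuclideanSpace ℝ (Fin N) → ℝ → ℝ≥0∞ := fun x t =>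
    ENNReal.ofReal (M * (‖x - z‖ ^ 2 + t) ^ (-(a / 2))) with hV
  set I : EuclideanSpace ℝ (Fin N) → ℝ → ℝ≥0∞ := fun x t =>
    ∫⁻ y, ENNReal.ofReal (heatKernel N (x - y) t) * ENNReal.ofReal (u₀ y) with hI
  have hI_meas : Measurable (Function.uncurry I) := by
    refine Measurable.lintegral_prod_right'
      (f := fun q : (EuclideanSpace ℝ (Fin N) × ℝ) × EuclideanSpace ℝ (Fin N) =>
        ENNReal.ofReal (heatKernel N (q.1.1 - q.2) q.1.2) * ENNReal.ofReal (u₀ q.2)) ?_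
    exact ((measurable_heatKernel N).comp
      (f := fun q : (EuclideanSpace ℝ (Fin N) × ℝ) × EuclideanSpace ℝ (Fin N) =>
        (q.1.1 - q.2, q.1.2)) (by fun_prop)).ennreal_ofReal.mul
      (hu₀.comp measurable_snd).ennreal_ofReal
  have hI_le (x : EuclideanSpace ℝ (Fin N)) (t : ℝ) (ht : 0 < t) :
      I x t ≤ ENNReal.ofReal (C₁ * c * b * (‖x - z‖ ^ 2 + t) ^ (-(a / 2))) := by
    have : Nonempty (Fin N) := ⟨⟨0, hN⟩⟩
    have hne : ∀ᵐ y : EuclideanSpace ℝ (Fin N), y ≠ z := compl_mem_ae_iff.2 (measure_singleton z)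
    calc I x t ≤ ∫⁻ y, ENNReal.ofReal (c * b) * (ENNReal.ofReal (heatKernel N (x - z - (y - z)) t) *
          ENNReal.ofReal (‖y - z‖ ^ (-a))) := by
          refine lintegral_mono_ae ?_
          filter_upwards [hne] with y hy
          rw [sub_sub_sub_cancel_right, mul_left_comm, ← ENNReal.ofReal_mul (p := c * b) (by positivity),
            ha, ← neg_div]
          gcongr
          exact hbound y hy
      _ = ENNReal.ofReal (c * b) * ∫⁻ y, ENNReal.ofReal (heatKernel N (x - z - y) t) *
          ENNReal.ofReal (‖y‖ ^ (-a)) := by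
          rw [lintegral_const_mul' _ _ ENNReal.ofReal_ne_top,
            lintegral_sub_right_eq_self (fun y => ENNReal.ofReal (heatKernel N (x - z - y) t) *
              ENNReal.ofReal (‖y‖ ^ (-a))) z]
      _ ≤ ENNReal.ofReal (c * b) *
          ENNReal.ofReal (C₁ * (‖x - z‖ ^ 2 + t) ^ (-(a / 2))) := by
          gcongr
          exact H₁ (x - z) t ht
      _ = _ := by
          rw [← ENNReal.ofReal_mul (by positivity)]
          congr 1
          ring
  have hD_le (x : EuclideanSpace ℝ (Fin N)) (t : ℝ) (ht : 0 < t) :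
      duhamel N (fun y s => ENNReal.ofReal (‖y‖ ^ (-γ)) * V y s ^ p) x t ≤
        ENNReal.ofReal (C₁ * c * b * (‖x - z‖ ^ 2 + t) ^ (-(a / 2))) := by
    calc _ ≤ duhamel N (fun y s => ENNReal.ofReal (M ^ p) *
          ENNReal.ofReal (‖y‖ ^ (-γ) * (‖y - z‖ ^ 2 + s) ^ (-(1 + a / 2)))) x t := by
          refine duhamel_mono (fun y s hs => le_of_eq ?_) x t
          rw [hV, ENNReal.ofReal_rpow_of_nonneg (by positivity) hp0.le,
            ← ENNReal.ofReal_mul (by positivity), ← ENNReal.ofReal_mul (by positivity),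
            mul_rpow hM0.le (by positivity), ← rpow_mul (by positivity), neg_mul, hap]
          congr 1
          ring
      _ ≤ ENNReal.ofReal (M ^ p) *
          ENNReal.ofReal (C₂ * ‖z‖ ^ (-γ) * (‖x - z‖ ^ 2 + t) ^ (-(a / 2))) := by
          rw [duhamel_const_mul ENNReal.ofReal_ne_top]
          gcongr
          exact H₂ z hz x t ht
      _ ≤ _ := by
          rw [← ENNReal.ofReal_mul (by positivity)]
          refine ENNReal.ofReal_le_ofReal ?_
          calc _ = C₂ * M ^ p * ‖z‖ ^ (-γ) * (‖x - z‖ ^ 2 + t) ^ (-(a / 2)) := by ring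
            _ ≤ _ := by gcongr
  obtain ⟨u, hu, huV, hsol⟩ := exists_mild_solution hp0
    (w := fun y : EuclideanSpace ℝ (Fin N) => ENNReal.ofReal (‖y‖ ^ (-γ))) (by fun_prop) hI_meas
    (V := V) fun x t ht => by
      refine (add_le_add (hI_le x t ht) (hD_le x t ht)).trans_eq ?_
      rw [← ENNReal.ofReal_add (by positivity) (by positivity), hV]
      congr 1
      rw [hM]
      ring
  exact ⟨_, isGlobalSol_toReal hp0.le hu₀ hu₀_nonneg hu
    (fun x t ht => ((huV x t ht).trans_lt ENNReal.ofReal_lt_top).ne) hsol⟩
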